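/- Suppose Assumptions 1 and 3 hold, only D is mismeasured (Z'=Z and Y'=Y almost surely), the measurement error of D satisfies: D' is independent of (Y_1, Y_0, D_1, D_0) given (D, Z); all conditioning events have positive probability; P(U=c) > 0, P(U=n) > 0; SN_D^1 + SP_D^1 − 1 > 0; RD_{Y|Z} > 0 (so that CACE' ≥ 0); and P(D'=1|Y=1,Z=1) ≥ P(D'=1|Y=0,Z=1). Then: SP_D^1 ≥ 1 − P(D'=1|Y=0,Z=1); SN_D^1 ≥ P(D'=1|Y=1,Z=1); SN_D^1 ≤ [P(Y=1,D'=1|Z=1) − (1−SP_D^1)·P(Y=1|Z=0)] / RD_{Y|Z}; and P(D'=1|Y=1,Z=1) × RD_{Y|Z} / P(D'=1|Z=1) ≤ CACE ≤ 1, where CACE = E(Y_1 − Y_0 | U=c). -/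

import Mathlib

open MeasureTheory ProbabilityTheory

noncomputable def pr {Ω : Type*} [MeasurableSpace Ω] (μ : MeasureTheory.Measure Ω)
    (A : Set Ω) : ℝ := (μ A).toReal

noncomputable def cpr {Ω : Type*} [MeasurableSpace Ω] (μ : MeasureTheory.Measure Ω)
    (B A : Set Ω) : ℝ := (ProbabilityTheory.cond μ B A).toReal

def bin01 : Set ℝ := {0, 1}

lemma cpr_eq_div {Ω : Type*} [MeasurableSpace Ω] (μ : Measure Ω) {B : Set Ω}
    (hB : MeasurableSet B) (A : Set Ω) : cpr μ B A = μ.real (B ∩ A) / μ.real B := by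
  rw [cpr, cond_apply hB, ENNReal.toReal_mul, ENNReal.toReal_inv, mul_comm, div_eq_mul_inv]
  rfl

lemma measurableSet_eq_value {Ω : Type*} [MeasurableSpace Ω] {f : Ω → ℝ} (hf : Measurable f)
    (x : ℝ) : MeasurableSet {ω | f ω = x} :=
  hf (measurableSet_singleton x)

lemma measureReal_split_binary {Ω : Type*} [MeasurableSpace Ω] (μ : Measure Ω) [IsFiniteMeasure μ]
    {f : Ω → ℝ} (hf : Measurable f) (hbin : ∀ ω, f ω = 0 ∨ f ω = 1) (A : Set Ω) :
    μ.real A = μ.real (A ∩ {ω | f ω = 0}) + μ.real (A ∩ {ω | f ω = 1}) := by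
  rw [← measureReal_inter_add_sdiff (s := A) (measurableSet_eq_value hf 0)]
  congr 2
  ext ω
  rcases hbin ω with h | h <;> simp [h]

lemma integral_binary {Ω : Type*} [MeasurableSpace Ω] (μ : Measure Ω)
    {f : Ω → ℝ} (hf : Measurable f) (hbin : ∀ ω, f ω = 0 ∨ f ω = 1) :
    ∫ ω, f ω ∂μ = μ.real {ω | f ω = 1} := by
  rw [← integral_indicator_one (measurableSet_eq_value hf 1)]
  congr 1
  ext ω
  rcases hbin ω with h | h <;> simp [Set.indicator, h]

lemma integrable_binary {Ω : Type*} [MeasurableSpace Ω] (μ : Measure Ω) [IsFiniteMeasure μ]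
    {f : Ω → ℝ} (hf : Measurable f) (hbin : ∀ ω, f ω = 0 ∨ f ω = 1) : Integrable f μ := by
  refine Integrable.of_bound hf.aestronglyMeasurable 1 (ae_of_all _ fun ω => ?_)
  rcases hbin ω with h | h <;> simp [h]

/-- The misclassification bounds in terms of the cell probabilities `a, b, c, d` of
`(D₁, Y₁) = (1,1), (1,0), (0,1), (0,0)`, with `e = P(D₁ = 1, Y₀ = 1)` and `s₁`, `s₀` the
true and false positive rates. -/
lemma misclassification_bounds {a b c d e s₁ s₀ : ℝ} (hb : 0 ≤ b) (hc : 0 ≤ c)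
    (hd : 0 ≤ d) (he : 0 ≤ e) (hs₀ : 0 ≤ s₀) (hs : s₀ < s₁) (hab : 0 < a + b)
    (hac : 0 < a + c) (hbd : 0 < b + d) (hae : 0 < a - e) :
    s₀ ≤ (s₁ * b + s₀ * d) / (b + d)
    ∧ (s₁ * a + s₀ * c) / (a + c) ≤ s₁
    ∧ s₁ ≤ ((s₁ * a + s₀ * c) - s₀ * (e + c)) / (a - e)
    ∧ (s₁ * a + s₀ * c) / (a + c) * (a - e) / (s₁ * (a + b) + s₀ * (c + d)) ≤ (a - e) / (a + b)
    ∧ (a - e) / (a + b) ≤ 1 := by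
  have hs' : 0 ≤ s₁ - s₀ := by linarith
  have hden : 0 < s₁ * (a + b) + s₀ * (c + d) := by
    have := mul_pos (hs₀.trans_lt hs) hab
    positivity
  refine ⟨?_, ?_, ?_, ?_, ?_⟩
  · rw [le_div_iff₀ hbd]
    linarith [mul_nonneg hs' hb]
  · rw [div_le_iff₀ hac]
    linarith [mul_nonneg hs' hc]
  · rw [le_div_iff₀ hae]
    linarith [mul_nonneg hs' he]
  · rw [mul_div_right_comm, div_eq_mul_inv (a - e), mul_comm (a - e)]
    refine mul_le_mul_of_nonneg_right ?_ hae.le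
    rw [inv_eq_one_div, div_div, div_le_div_iff₀ (mul_pos hac hden) hab]
    linarith [mul_nonneg hs' (mul_nonneg hc hab.le),
      mul_nonneg hs₀ (mul_nonneg hac.le (add_nonneg hc hd))]
  · rw [div_le_one hab]
    linarith

set_option maxHeartbeats 1000000 in
theorem stmt14 {Ω : Type*} [MeasurableSpace Ω]
    (μ : MeasureTheory.Measure Ω) [IsProbabilityMeasure μ]
    (Z D Y D' D1 D0 Y1 Y0 : Ω → ℝ)
    (h_meas_Z : Measurable Z)
    (h_meas_D : Measurable D)
    (h_meas_Y : Measurable Y)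
    (h_meas_Dp : Measurable D')
    (h_meas_D1 : Measurable D1)
    (h_meas_D0 : Measurable D0)
    (h_meas_Y1 : Measurable Y1)
    (h_meas_Y0 : Measurable Y0)
    (h_bin_Z : ∀ ω, Z ω = 0 ∨ Z ω = 1)
    (h_bin_Dp : ∀ ω, D' ω = 0 ∨ D' ω = 1)
    (h_bin_D1 : ∀ ω, D1 ω = 0 ∨ D1 ω = 1)
    (h_bin_D0 : ∀ ω, D0 ω = 0 ∨ D0 ω = 1)
    (h_bin_Y1 : ∀ ω, Y1 ω = 0 ∨ Y1 ω = 1)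
    (h_bin_Y0 : ∀ ω, Y0 ω = 0 ∨ Y0 ω = 1)
    (h_consD : ∀ ω, D ω = Z ω * D1 ω + (1 - Z ω) * D0 ω)
    (h_consY : ∀ ω, Y ω = Z ω * Y1 ω + (1 - Z ω) * Y0 ω)
    (h_indep : IndepFun Z (fun ω => (Y1 ω, Y0 ω, D1 ω, D0 ω)) μ)
    (h_mono : ∀ᵐ ω ∂μ, D0 ω ≤ D1 ω)
    (h_exclA : cpr μ {ω | D1 ω = 1 ∧ D0 ω = 1} {ω | Y1 ω = 1}
        = cpr μ {ω | D1 ω = 1 ∧ D0 ω = 1} {ω | Y0 ω = 1})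
    (h_exclN : cpr μ {ω | D1 ω = 0 ∧ D0 ω = 0} {ω | Y1 ω = 1}
        = cpr μ {ω | D1 ω = 0 ∧ D0 ω = 0} {ω | Y0 ω = 1})
    (h_strmono : ∀ᵐ ω ∂μ, D0 ω = 0)
    (h_ndD : ∀ d ∈ bin01, ∀ d' ∈ bin01, ∀ z ∈ bin01, ∀ d1 ∈ bin01, ∀ d0 ∈ bin01, ∀ y1 ∈ bin01, ∀ y0 ∈ bin01,
      μ ({ω | D ω = d} ∩ {ω | Z ω = z} ∩ {ω | D1 ω = d1} ∩ {ω | D0 ω = d0} ∩ {ω | Y1 ω = y1} ∩ {ω | Y0 ω = y0}) ≠ 0 →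
      cpr μ ({ω | D ω = d} ∩ {ω | Z ω = z} ∩ {ω | D1 ω = d1} ∩ {ω | D0 ω = d0} ∩ {ω | Y1 ω = y1} ∩ {ω | Y0 ω = y0}) {ω | D' ω = d'}
        = cpr μ ({ω | D ω = d} ∩ {ω | Z ω = z}) {ω | D' ω = d'})
    (h_posYZ : ∀ y ∈ bin01, ∀ z ∈ bin01,
      μ ({ω | Y ω = y} ∩ {ω | Z ω = z}) ≠ 0)
    (h_posDZ1 : ∀ d ∈ bin01, μ ({ω | D ω = d} ∩ {ω | Z ω = 1}) ≠ 0)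
    (h_Uc : 0 < pr μ {ω | D1 ω = 1 ∧ D0 ω = 0})
    (h_Un : 0 < pr μ {ω | D1 ω = 0 ∧ D0 ω = 0})
    (SND1 SPD1 : ℝ)
    (h_SND1 : SND1 = cpr μ ({ω | D ω = 1} ∩ {ω | Z ω = 1}) {ω | D' ω = 1})
    (h_SPD1 : SPD1 = cpr μ ({ω | D ω = 0} ∩ {ω | Z ω = 1}) {ω | D' ω = 0})
    (h_rD1 : 0 < SND1 + SPD1 - 1)
    (h_RDY : 0 < (cpr μ {ω | Z ω = 1} {ω | Y ω = 1} - cpr μ {ω | Z ω = 0} {ω | Y ω = 1}))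
    (CACE : ℝ)
    (h_CACE : CACE = ∫ ω, (Y1 ω - Y0 ω) ∂(ProbabilityTheory.cond μ {ω | D1 ω = 1 ∧ D0 ω = 0}))
    (h_cond : cpr μ ({ω | Y ω = 0} ∩ {ω | Z ω = 1}) {ω | D' ω = 1} ≤ cpr μ ({ω | Y ω = 1} ∩ {ω | Z ω = 1}) {ω | D' ω = 1}) :
    1 - cpr μ ({ω | Y ω = 0} ∩ {ω | Z ω = 1}) {ω | D' ω = 1} ≤ SPD1
    ∧ cpr μ ({ω | Y ω = 1} ∩ {ω | Z ω = 1}) {ω | D' ω = 1} ≤ SND1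
    ∧ SND1 ≤ (cpr μ {ω | Z ω = 1} ({ω | Y ω = 1} ∩ {ω | D' ω = 1}) - (1 - SPD1) * cpr μ {ω | Z ω = 0} {ω | Y ω = 1}) / (cpr μ {ω | Z ω = 1} {ω | Y ω = 1} - cpr μ {ω | Z ω = 0} {ω | Y ω = 1})
    ∧ cpr μ ({ω | Y ω = 1} ∩ {ω | Z ω = 1}) {ω | D' ω = 1} * (cpr μ {ω | Z ω = 1} {ω | Y ω = 1} - cpr μ {ω | Z ω = 0} {ω | Y ω = 1}) / cpr μ {ω | Z ω = 1} {ω | D' ω = 1} ≤ CACE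
    ∧ CACE ≤ 1 := by
  have h0 : (0 : ℝ) ∈ bin01 := by simp [bin01]
  have h1 : (1 : ℝ) ∈ bin01 := by simp [bin01]
  have mZ := measurableSet_eq_value h_meas_Z
  have mD := measurableSet_eq_value h_meas_D
  have mY := measurableSet_eq_value h_meas_Y
  have mD1 := measurableSet_eq_value h_meas_D1
  have mD0 := measurableSet_eq_value h_meas_D0
  have mY1 := measurableSet_eq_value h_meas_Y1
  have mY0 := measurableSet_eq_value h_meas_Y0
  have h_bin_D : ∀ ω, D ω = 0 ∨ D ω = 1 := by
    intro ω
    rw [h_consD]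
    rcases h_bin_Z ω with h | h <;> simp [h, h_bin_D0 ω, h_bin_D1 ω]
  have h_bin_Y : ∀ ω, Y ω = 0 ∨ Y ω = 1 := by
    intro ω
    rw [h_consY]
    rcases h_bin_Z ω with h | h <;> simp [h, h_bin_Y0 ω, h_bin_Y1 ω]
  have indep : ∀ z (S : Set (ℝ × ℝ × ℝ × ℝ)), MeasurableSet S →
      μ.real ({ω | Z ω = z} ∩ {ω | (Y1 ω, Y0 ω, D1 ω, D0 ω) ∈ S})
        = μ.real {ω | Z ω = z} * μ.real {ω | (Y1 ω, Y0 ω, D1 ω, D0 ω) ∈ S} := by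
    intro z S hS
    have := h_indep.measure_inter_preimage_eq_mul {z} S (measurableSet_singleton z) hS
    simp only [Measure.real, ← ENNReal.toReal_mul]
    exact congrArg ENNReal.toReal this
  have pos : ∀ {A : Set Ω}, μ A ≠ 0 → 0 < μ.real A := fun h =>
    ENNReal.toReal_pos h (measure_ne_top _ _)
  have hZ1 : 0 < μ.real {ω | Z ω = 1} :=
    (pos (h_posYZ 1 h1 1 h1)).trans_le (measureReal_mono Set.inter_subset_right)
  have hZ0 : 0 < μ.real {ω | Z ω = 0} :=
    (pos (h_posYZ 1 h1 0 h0)).trans_le (measureReal_mono Set.inter_subset_right)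
  set q := μ.real {ω | Z ω = 1}
  obtain ⟨p, hp⟩ : ∃ p : ℝ → ℝ → ℝ, ∀ i y, p i y = μ.real ({ω | D1 ω = i} ∩ {ω | Y1 ω = y}) :=
    ⟨_, fun _ _ => rfl⟩
  obtain ⟨s, hs⟩ : ∃ s : ℝ → ℝ, ∀ i, s i = cpr μ ({ω | D ω = i} ∩ {ω | Z ω = 1}) {ω | D' ω = 1} :=
    ⟨_, fun _ => rfl⟩
  have hp0 : ∀ i y, 0 ≤ p i y := fun i y => (hp i y).symm ▸ measureReal_nonneg
  have cell : ∀ i y, μ.real ({ω | Y ω = y} ∩ {ω | Z ω = 1} ∩ {ω | D ω = i}) = q * p i y := by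
    intro i y
    have := indep 1 {w | w.2.2.1 = i ∧ w.1 = y}
      ((measurableSet_eq_fun (by fun_prop) (by fun_prop)).inter
        (measurableSet_eq_fun (by fun_prop) (by fun_prop)))
    rw [hp]
    refine Eq.trans (congrArg μ.real ?_) this
    ext ω
    simp only [Set.mem_inter_iff, Set.mem_ofPred_eq, h_consD, h_consY]
    constructor
    · rintro ⟨⟨h, hz⟩, h'⟩
      simp_all
    · rintro ⟨hz, h, h'⟩
      simp_all
  have nondiff : ∀ i ∈ bin01, ∀ y ∈ bin01, ∀ y0 ∈ bin01,
      μ.real ({ω | D ω = i} ∩ {ω | Z ω = 1} ∩ {ω | D1 ω = i} ∩ {ω | D0 ω = 0} ∩ {ω | Y1 ω = y}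
          ∩ {ω | Y0 ω = y0} ∩ {ω | D' ω = 1})
        = s i * μ.real ({ω | D ω = i} ∩ {ω | Z ω = 1} ∩ {ω | D1 ω = i} ∩ {ω | D0 ω = 0}
          ∩ {ω | Y1 ω = y} ∩ {ω | Y0 ω = y0}) := by
    intro i hi y hy y0 hy0
    set B := {ω | D ω = i} ∩ {ω | Z ω = 1} ∩ {ω | D1 ω = i} ∩ {ω | D0 ω = 0}
          ∩ {ω | Y1 ω = y} ∩ {ω | Y0 ω = y0}
    have mB : MeasurableSet B :=
      (((((mD i).inter (mZ 1)).inter (mD1 i)).inter (mD0 0)).inter (mY1 y)).inter (mY0 y0)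
    by_cases hμ : μ B = 0
    · simp [Measure.real, measure_mono_null Set.inter_subset_left hμ, hμ]
    · have := h_ndD i hi 1 h1 1 h1 i hi 0 h0 y hy y0 hy0 hμ
      rw [hs, ← this, cpr_eq_div μ mB, div_mul_cancel₀ _ (pos hμ).ne']
  have cell_eq : ∀ i y (A : Set Ω), μ.real ({ω | Y ω = y} ∩ {ω | Z ω = 1} ∩ {ω | D ω = i} ∩ A)
      = μ.real ({ω | D ω = i} ∩ {ω | Z ω = 1} ∩ {ω | D1 ω = i} ∩ {ω | D0 ω = 0}
          ∩ {ω | Y1 ω = y} ∩ A) := by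
    intro i y A
    refine measureReal_congr ?_
    filter_upwards [h_strmono] with ω hω
    refine propext ?_
    change (((Y ω = y ∧ Z ω = 1) ∧ D ω = i) ∧ ω ∈ A)
      ↔ (((((D ω = i ∧ Z ω = 1) ∧ D1 ω = i) ∧ D0 ω = 0) ∧ Y1 ω = y) ∧ ω ∈ A)
    have hy := h_consY ω
    have hd := h_consD ω
    constructor
    · rintro ⟨⟨⟨h, hz⟩, h'⟩, hA⟩
      simp_all
    · rintro ⟨⟨⟨⟨⟨h, hz⟩, h'⟩, h''⟩, h3⟩, hA⟩
      simp_all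
  have cell' : ∀ i ∈ bin01, ∀ y ∈ bin01,
      μ.real ({ω | Y ω = y} ∩ {ω | Z ω = 1} ∩ {ω | D ω = i} ∩ {ω | D' ω = 1})
        = s i * (q * p i y) := by
    intro i hi y hy
    have huniv := cell_eq i y Set.univ
    rw [Set.inter_univ, Set.inter_univ] at huniv
    rw [← cell, huniv, cell_eq,
      measureReal_split_binary μ h_meas_Y0 h_bin_Y0,
      measureReal_split_binary μ h_meas_Y0 h_bin_Y0 (_ ∩ {ω | Y1 ω = y}),
      Set.inter_right_comm _ {ω | D' ω = 1}, nondiff i hi y hy 0 h0,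
      Set.inter_right_comm _ {ω | D' ω = 1}, nondiff i hi y hy 1 h1, mul_add]
  have hYZ : ∀ y, μ.real ({ω | Y ω = y} ∩ {ω | Z ω = 1}) = q * (p 0 y + p 1 y) := by
    intro y
    rw [measureReal_split_binary μ h_meas_D h_bin_D, cell, cell, mul_add]
  have hYZ' : ∀ y ∈ bin01, μ.real ({ω | Y ω = y} ∩ {ω | Z ω = 1} ∩ {ω | D' ω = 1})
      = q * (s 0 * p 0 y + s 1 * p 1 y) := by
    intro y hy
    rw [measureReal_split_binary μ h_meas_D h_bin_D, Set.inter_right_comm, cell' 0 h0 y hy,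
      Set.inter_right_comm, cell' 1 h1 y hy]
    ring
  have hpyy : ∀ y ∈ bin01, 0 < p 0 y + p 1 y := by
    intro y hy
    have := pos (h_posYZ y hy 1 h1)
    rw [hYZ] at this
    exact pos_of_mul_pos_right this hZ1.le
  have hY1 : cpr μ {ω | Z ω = 1} {ω | Y ω = 1} = p 0 1 + p 1 1 := by
    rw [cpr_eq_div μ (mZ 1), Set.inter_comm, hYZ, mul_div_cancel_left₀ _ hZ1.ne']
  have hYD' : cpr μ {ω | Z ω = 1} ({ω | Y ω = 1} ∩ {ω | D' ω = 1})
      = s 0 * p 0 1 + s 1 * p 1 1 := by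
    rw [cpr_eq_div μ (mZ 1), ← Set.inter_assoc, Set.inter_comm {ω | Z ω = 1}, hYZ' 1 h1,
      mul_div_cancel_left₀ _ hZ1.ne']
  have hD' : cpr μ {ω | Z ω = 1} {ω | D' ω = 1}
      = (s 0 * p 0 0 + s 1 * p 1 0) + (s 0 * p 0 1 + s 1 * p 1 1) := by
    rw [cpr_eq_div μ (mZ 1), measureReal_split_binary μ h_meas_Y h_bin_Y,
      Set.inter_comm _ {ω | Y ω = 0}, Set.inter_comm _ {ω | Y ω = 1}, ← Set.inter_assoc,
      ← Set.inter_assoc, hYZ' 1 h1, hYZ' 0 h0, ← mul_add, mul_div_cancel_left₀ _ hZ1.ne']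
  have hD'Y : ∀ y ∈ bin01, cpr μ ({ω | Y ω = y} ∩ {ω | Z ω = 1}) {ω | D' ω = 1}
      = (s 0 * p 0 y + s 1 * p 1 y) / (p 0 y + p 1 y) := by
    intro y hy
    rw [cpr_eq_div μ ((mY y).inter (mZ 1)), hYZ' y hy, hYZ, mul_div_mul_left _ _ hZ1.ne']
  have hSP : SPD1 = 1 - s 0 := by
    have hne := (pos (h_posDZ1 0 h0)).ne'
    rw [h_SPD1, hs, cpr_eq_div μ ((mD 0).inter (mZ 1)), cpr_eq_div μ ((mD 0).inter (mZ 1)),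
      eq_sub_iff_add_eq, ← add_div, ← measureReal_split_binary μ h_meas_Dp h_bin_Dp,
      div_self hne]
  have hSN : SND1 = s 1 := by rw [h_SND1, hs]
  have hs0 : 0 ≤ s 0 := by
    rw [hs]
    exact ENNReal.toReal_nonneg
  have strat : ∀ i (A : Set Ω), μ.real ({ω | D1 ω = i ∧ D0 ω = 0} ∩ A)
      = μ.real ({ω | D1 ω = i} ∩ A) := by
    intro i A
    refine measureReal_congr ?_
    filter_upwards [h_strmono] with ω hω
    refine propext ?_
    change ((D1 ω = i ∧ D0 ω = 0) ∧ ω ∈ A) ↔ (D1 ω = i ∧ ω ∈ A)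
    simp [hω]
  have mS : ∀ i, MeasurableSet {ω | D1 ω = i ∧ D0 ω = 0} := fun i => (mD1 i).inter (mD0 0)
  set e := μ.real ({ω | D1 ω = 1} ∩ {ω | Y0 ω = 1}) with he
  have hn : μ.real ({ω | D1 ω = 0} ∩ {ω | Y0 ω = 1}) = p 0 1 := by
    rw [cpr_eq_div μ (mS 0), cpr_eq_div μ (mS 0), strat, strat, ← hp] at h_exclN
    exact ((div_left_inj' (ne_of_gt h_Un)).1 h_exclN).symm
  have hY0 : cpr μ {ω | Z ω = 0} {ω | Y ω = 1} = e + p 0 1 := by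
    have h := indep 0 {w | w.2.1 = 1} (measurableSet_eq_fun (by fun_prop) (by fun_prop))
    have h' : {ω | Z ω = 0} ∩ {ω | Y ω = 1}
        = {ω | Z ω = 0} ∩ {ω | (Y1 ω, Y0 ω, D1 ω, D0 ω) ∈ {w : ℝ × ℝ × ℝ × ℝ | w.2.1 = 1}} := by
      ext ω
      simp only [Set.mem_inter_iff, Set.mem_ofPred_eq, h_consY]
      refine and_congr_right fun hz => ?_
      simp [hz]
    rw [cpr_eq_div μ (mZ 0), h', h, mul_div_cancel_left₀ _ hZ0.ne']
    change μ.real {ω | Y0 ω = 1} = _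
    rw [measureReal_split_binary μ h_meas_D1 h_bin_D1, Set.inter_comm, hn, Set.inter_comm,
      add_comm]
  have hc : μ.real {ω | D1 ω = 1 ∧ D0 ω = 0} = p 1 1 + p 1 0 := by
    rw [← Set.inter_univ {ω | D1 ω = 1 ∧ D0 ω = 0}, strat, Set.inter_univ,
      measureReal_split_binary μ h_meas_Y1 h_bin_Y1, ← hp, ← hp, add_comm]
  have hCACE : CACE = (p 1 1 - e) / (p 1 1 + p 1 0) := by
    rw [h_CACE, integral_sub (integrable_binary _ h_meas_Y1 h_bin_Y1)
      (integrable_binary _ h_meas_Y0 h_bin_Y0), integral_binary _ h_meas_Y1 h_bin_Y1,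
      integral_binary _ h_meas_Y0 h_bin_Y0]
    change cpr μ _ _ - cpr μ _ _ = _
    rw [cpr_eq_div μ (mS 1), cpr_eq_div μ (mS 1), strat, strat, ← hp, ← he, hc, ← sub_div]
  have hab : 0 < p 1 1 + p 1 0 := hc ▸ h_Uc
  rw [hY1, hY0] at h_RDY
  obtain ⟨b1, b2, b3, b4, b5⟩ := misclassification_bounds (hp0 1 0) (hp0 0 1) (hp0 0 0)
    (measureReal_nonneg : 0 ≤ e) hs0 (by linarith : s 0 < s 1) hab
    (by linarith [hpyy 1 h1]) (by linarith [hpyy 0 h0]) (by linarith)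
  rw [hY1, hY0, hYD', hD', hD'Y 1 h1, hD'Y 0 h0, hCACE, hSN, hSP, sub_sub_cancel,
    show p 0 1 + p 1 1 - (e + p 0 1) = p 1 1 - e by ring,
    show s 0 * p 0 0 + s 1 * p 1 0 + (s 0 * p 0 1 + s 1 * p 1 1)
      = s 1 * (p 1 1 + p 1 0) + s 0 * (p 0 1 + p 0 0) by ring,
    add_comm (s 0 * p 0 1), add_comm (p 0 1) (p 1 1), add_comm (s 0 * p 0 0),
    add_comm (p 0 0) (p 1 0)]
  exact ⟨sub_le_sub_left b1 1, b2, b3, b4, b5⟩
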